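/- Let I be a monomial ideal in k[ℕA] and F a face of A. The prime ideal p_F is an associated prime of I (i.e., p_F ∈ Ass(k[ℕA]/I)) if and only if I has a standard pair belonging to F. -/

import Mathlib

open scoped BigOperators

namespace StdPairsPaper

/-- The coercion of a lattice point to a real vector. -/
def toR {d : ℕ} (v : Fin d → ℤ) : Fin d → ℝ := fun i => (v i : ℝ)

/-- The cone of nonnegative real combinations of (the real images of) elements of `S`. -/
def cone {d : ℕ} (S : Set (Fin d → ℤ)) : Set (Fin d → ℝ) :=
  {x | ∃ (t : Finset (Fin d → ℤ)) (c : (Fin d → ℤ) → ℝ),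
    (t : Set (Fin d → ℤ)) ⊆ S ∧ (∀ v, 0 ≤ c v) ∧ x = ∑ v ∈ t, c v • toR v}

/-- `ℕS`, the submonoid of `ℤ^d` generated by `S`. -/
def NSemi {d : ℕ} (S : Set (Fin d → ℤ)) : AddSubmonoid (Fin d → ℤ) :=
  AddSubmonoid.closure S

/-- `ℤS`, the subgroup of `ℤ^d` generated by `S`. -/
def ZGrp {d : ℕ} (S : Set (Fin d → ℤ)) : AddSubgroup (Fin d → ℤ) :=
  AddSubgroup.closure S

/-- `ℝS`, the real linear span of `S`. -/
def RSpan {d : ℕ} (S : Set (Fin d → ℤ)) : Submodule ℝ (Fin d → ℝ) :=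
  Submodule.span ℝ (toR '' S)

/-- `A` is a configuration: a finite set of nonzero lattice points whose `ℤ`-span is `ℤ^d`
and whose nonnegative real cone is strongly convex (contains no line, i.e. is pointed). -/
structure IsConfig {d : ℕ} (A : Set (Fin d → ℤ)) : Prop where
  (finite : A.Finite)
  (nonzero : (0 : Fin d → ℤ) ∉ A)
  (spans : ZGrp A = ⊤)
  (pointed : ∀ x ∈ cone A, -x ∈ cone A → x = 0)

/-- `F` is a face of the configuration `A`: `F ⊆ A`, the cone over `F` is an extreme
subset (face) of the cone over `A`, and `ℝ_{≥0}F ∩ A = F`. -/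
def IsFace {d : ℕ} (A F : Set (Fin d → ℤ)) : Prop :=
  F ⊆ A ∧ IsExtreme ℝ (cone A) (cone F) ∧ cone F ∩ (toR '' A) = toR '' F

/-- The set `a + ℕF`. -/
def cell {d : ℕ} (a : Fin d → ℤ) (F : Set (Fin d → ℤ)) : Set (Fin d → ℤ) :=
  {x | ∃ f ∈ NSemi F, x = a + f}

/-- Two pairs `(a,F)` and `(b,F)` belonging to the same face `F` overlap: `a - b ∈ ℤF`. -/
def Overlap {d : ℕ} (F : Set (Fin d → ℤ)) (a b : Fin d → ℤ) : Prop :=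
  a - b ∈ ZGrp F

/-- The pair `(a,F)` divides the pair `(b,G)`:
there is `c ∈ ℕA` with `a + c + ℕF ⊆ b + ℕG`. -/
def PairDvd {d : ℕ} (A : Set (Fin d → ℤ)) (a : Fin d → ℤ) (F : Set (Fin d → ℤ))
    (b : Fin d → ℤ) (G : Set (Fin d → ℤ)) : Prop :=
  ∃ c ∈ NSemi A, cell (a + c) F ⊆ cell b G

/-- `E` is the exponent set of a monomial ideal of `ℕA`: `E ⊆ ℕA` and `E + ℕA ⊆ E`. -/
def IsExpSet {d : ℕ} (A E : Set (Fin d → ℤ)) : Prop :=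
  E ⊆ (NSemi A : Set (Fin d → ℤ)) ∧ ∀ e ∈ E, ∀ c ∈ NSemi A, e + c ∈ E

/-- The standard monomials of `E`: `ℕA ∖ E`. -/
def stdSet {d : ℕ} (A E : Set (Fin d → ℤ)) : Set (Fin d → ℤ) :=
  (NSemi A : Set (Fin d → ℤ)) \ E

/-- `(a,F)` is a proper pair of `E`: a pair of `A` with `a + ℕF ⊆ std(E)`. -/
def ProperPair {d : ℕ} (A E : Set (Fin d → ℤ)) (a : Fin d → ℤ)
    (F : Set (Fin d → ℤ)) : Prop :=
  a ∈ NSemi A ∧ IsFace A F ∧ cell a F ⊆ stdSet A E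

/-- `(a,F)` is a standard pair of `E`: a proper pair of `E` maximal with respect to
the partial order `(a,F) ≼ (b,G) ↔ a + ℕF ⊆ b + ℕG`. -/
def StdPair {d : ℕ} (A E : Set (Fin d → ℤ)) (a : Fin d → ℤ)
    (F : Set (Fin d → ℤ)) : Prop :=
  ProperPair A E a F ∧
    ∀ b G, ProperPair A E b G → cell a F ⊆ cell b G → cell b G ⊆ cell a F

/-- The overlap class of the standard pair `(a,F)` of `E` is maximal with respect to
divisibility among overlap classes of standard pairs of `E`. -/
def MaxClass {d : ℕ} (A E : Set (Fin d → ℤ)) (a : Fin d → ℤ)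
    (F : Set (Fin d → ℤ)) : Prop :=
  ∀ b G, StdPair A E b G → PairDvd A a F b G → PairDvd A b G a F

noncomputable section

/-- The affine semigroup ring `k[ℕA]`. -/
abbrev SGRing {d : ℕ} (k : Type*) [Field k] (A : Set (Fin d → ℤ)) :=
  AddMonoidAlgebra k (NSemi A)

/-- The monomial `t^a` of `k[ℕA]`. -/
def mono {d : ℕ} (k : Type*) [Field k] (A : Set (Fin d → ℤ)) (a : (NSemi A)) :
    SGRing k A :=
  AddMonoidAlgebra.single a 1

/-- `I` is a monomial ideal of `k[ℕA]`: an ideal generated by monomials. -/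
def IsMonomialIdeal {d : ℕ} (k : Type*) [Field k] (A : Set (Fin d → ℤ))
    (I : Ideal (SGRing k A)) : Prop :=
  ∃ S : Set (NSemi A), I = Ideal.span ((fun a => mono k A a) '' S)

/-- The exponent set `E(I) = {a ∈ ℕA : t^a ∈ I}` of an ideal of `k[ℕA]`,
as a subset of `ℤ^d`. -/
def expSet {d : ℕ} (k : Type*) [Field k] (A : Set (Fin d → ℤ))
    (I : Ideal (SGRing k A)) : Set (Fin d → ℤ) :=
  {x | ∃ h : x ∈ NSemi A, mono k A ⟨x, h⟩ ∈ I}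

/-- The monomial prime ideal `p_F = ⟨t^a : a ∈ ℕA ∖ ℕF⟩` of `k[ℕA]`. -/
def primeF {d : ℕ} (k : Type*) [Field k] (A F : Set (Fin d → ℤ)) :
    Ideal (SGRing k A) :=
  Ideal.span {x | ∃ a : (NSemi A), (a : Fin d → ℤ) ∉ NSemi F ∧ x = mono k A a}

end

/-! ### The cone over a set of lattice points -/

theorem mem_cone_iff {d : ℕ} {S : Set (Fin d → ℤ)} {x : Fin d → ℝ} :
    x ∈ cone S ↔ x ∈ Submodule.span NNReal (toR '' S) := by
  constructor
  · rintro ⟨t, c, hts, hc, rfl⟩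
    exact Submodule.sum_mem _ fun v hv => Submodule.smul_mem _ (⟨c v, hc v⟩ : NNReal)
      (Submodule.subset_span ⟨v, hts hv, rfl⟩)
  · intro hx
    obtain ⟨l, hl, rfl⟩ := (Finsupp.mem_span_image_iff_linearCombination NNReal).1 hx
    exact ⟨l.support, fun v => l v, (Finsupp.mem_supported _ _).1 hl, fun v => (l v).2, rfl⟩

theorem add_mem_cone {d : ℕ} {S : Set (Fin d → ℤ)} {x y : Fin d → ℝ}
    (hx : x ∈ cone S) (hy : y ∈ cone S) : x + y ∈ cone S := by
  rw [mem_cone_iff] at *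
  exact add_mem hx hy

theorem smul_mem_cone {d : ℕ} {S : Set (Fin d → ℤ)} {x : Fin d → ℝ} {r : ℝ} (hr : 0 ≤ r)
    (hx : x ∈ cone S) : r • x ∈ cone S := by
  rw [mem_cone_iff] at *
  exact Submodule.smul_mem _ (⟨r, hr⟩ : NNReal) hx

theorem sum_mem_cone {d : ℕ} {S : Set (Fin d → ℤ)} {ι : Type*} {t : Finset ι}
    {f : ι → Fin d → ℝ} (h : ∀ i ∈ t, f i ∈ cone S) : ∑ i ∈ t, f i ∈ cone S := by
  simp only [mem_cone_iff] at *
  exact Submodule.sum_mem _ h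

theorem zero_mem_cone {d : ℕ} {S : Set (Fin d → ℤ)} : (0 : Fin d → ℝ) ∈ cone S :=
  mem_cone_iff.2 (Submodule.zero_mem _)

theorem toR_mem_cone {d : ℕ} {S : Set (Fin d → ℤ)} {v : Fin d → ℤ} (hv : v ∈ S) :
    toR v ∈ cone S :=
  mem_cone_iff.2 (Submodule.subset_span ⟨v, hv, rfl⟩)

theorem cone_mono {d : ℕ} {S T : Set (Fin d → ℤ)} (h : S ⊆ T) : cone S ⊆ cone T := by
  intro x hx
  rw [mem_cone_iff] at *
  exact Submodule.span_mono (Set.image_mono h) hx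

theorem toR_zero {d : ℕ} : toR (0 : Fin d → ℤ) = 0 := by
  ext; simp [toR]

theorem toR_add {d : ℕ} (v w : Fin d → ℤ) : toR (v + w) = toR v + toR w := by
  ext; simp [toR]

theorem toR_sub {d : ℕ} (v w : Fin d → ℤ) : toR (v - w) = toR v - toR w := by
  ext; simp [toR]

theorem toR_nsmul {d : ℕ} (n : ℕ) (v : Fin d → ℤ) : toR (n • v) = (n : ℝ) • toR v := by
  ext; simp [toR]

theorem toR_injective {d : ℕ} : Function.Injective (toR (d := d)) := by
  intro v w h
  ext i
  exact Int.cast_injective (congrFun h i)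

theorem toR_mem_cone_of_mem_NSemi {d : ℕ} {S : Set (Fin d → ℤ)} {v : Fin d → ℤ}
    (hv : v ∈ NSemi S) : toR v ∈ cone S := by
  induction hv using AddSubmonoid.closure_induction with
  | mem x hx => exact toR_mem_cone hx
  | zero => exact toR_zero ▸ zero_mem_cone
  | add x y _ _ hx hy => exact toR_add x y ▸ add_mem_cone hx hy

/-- Finitely many positive elements of a finite-dimensional rational space of real numbers remain
positive under some rational-valued linear form. -/
theorem exists_rat_linearMap_pos (V : Submodule ℚ ℝ) [FiniteDimensional ℚ V] (T : Finset V)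
    (hT : ∀ v ∈ T, 0 < (v : ℝ)) : ∃ φ : V →ₗ[ℚ] ℚ, ∀ v ∈ T, 0 < φ v := by
  let b := Module.finBasis ℚ V
  let U : Set (Fin (Module.finrank ℚ V) → ℝ) :=
    ⋂ v ∈ T, {r | 0 < ∑ i, (b.equivFun v i : ℝ) * r i}
  have hU : IsOpen U := isOpen_biInter_finset fun v _ =>
    isOpen_lt continuous_const (by fun_prop)
  have hne : U.Nonempty := by
    refine ⟨fun i => (b i : ℝ), Set.mem_iInter₂.2 fun v hv => ?_⟩
    have h := congrArg (Subtype.val) (b.sum_equivFun v)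
    have h' : ∑ i, (b.equivFun v i : ℝ) * (b i : ℝ) = v := by
      refine Eq.trans ?_ h
      rw [Submodule.coe_sum]
      exact Finset.sum_congr rfl fun i _ => (Rat.smul_def _ _).symm
    simpa only [Set.mem_ofPred_eq, h'] using hT v hv
  have hd : DenseRange (Pi.map fun (_ : Fin (Module.finrank ℚ V)) (q : ℚ) => (q : ℝ)) :=
    DenseRange.piMap fun _ => Rat.denseRange_cast
  obtain ⟨q, hq⟩ := hd.exists_mem_open hU hne
  refine ⟨b.constr ℚ q, fun v hv => ?_⟩
  have h : 0 < ∑ i, (b.equivFun v i : ℝ) * (q i : ℝ) := Set.mem_iInter₂.1 hq v hv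
  rw [Module.Basis.constr_apply_fintype]
  simp only [smul_eq_mul]
  exact_mod_cast h

theorem exists_nat_mul_eq {ι : Type*} (t : Finset ι) (q : ι → ℚ) (hq : ∀ i ∈ t, 0 ≤ q i) :
    ∃ D : ℕ, 0 < D ∧ ∃ n : ι → ℕ, ∀ i ∈ t, (D : ℚ) * q i = n i := by
  refine ⟨∏ i ∈ t, (q i).den, Finset.prod_pos fun i _ => (q i).den_pos, ?_⟩
  have h : ∀ i, ∃ n : ℕ, i ∈ t → ((∏ j ∈ t, (q j).den : ℕ) : ℚ) * q i = n := by
    intro i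
    by_cases hi : i ∈ t
    · obtain ⟨m, hm⟩ := Finset.dvd_prod_of_mem (fun j => (q j).den) hi
      obtain ⟨n, hn⟩ := Int.eq_ofNat_of_zero_le (Rat.num_nonneg.2 (hq i hi))
      refine ⟨m * n, fun _ => ?_⟩
      have h := Rat.mul_den_eq_num (q i)
      rw [hn] at h
      rw [hm]
      push_cast at h ⊢
      rw [← h]
      ring
    · exact ⟨0, fun h => absurd h hi⟩
  choose n hn using h
  exact ⟨n, hn⟩

/-- A lattice point of the real cone over `S` has a positive multiple in `ℕS`. -/
theorem exists_nsmul_mem_NSemi {d : ℕ} {S : Set (Fin d → ℤ)} {x : Fin d → ℤ}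
    (hx : toR x ∈ cone S) : ∃ m : ℕ, 0 < m ∧ m • x ∈ NSemi S := by
  classical
  obtain ⟨t, c, hts, hc, hxc⟩ := hx
  let V : Submodule ℚ ℝ := Submodule.span ℚ ((insert 1 (t.image c) : Finset ℝ) : Set ℝ)
  have : FiniteDimensional ℚ V := FiniteDimensional.span_finset ℚ _
  have h1 : (1 : ℝ) ∈ V := Submodule.subset_span (by simp)
  have hcV : ∀ v ∈ t, c v ∈ V := fun v hv =>
    Submodule.subset_span (Finset.mem_insert_of_mem (Finset.mem_image_of_mem c hv))
  let one : V := ⟨1, h1⟩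
  let e : t → V := fun v => ⟨c v, hcV v v.2⟩
  obtain ⟨φ, hφ⟩ := exists_rat_linearMap_pos V
    ((insert one (Finset.univ.image e)).filter fun v => 0 < (v : ℝ)) (by simp)
  have hφ1 : 0 < φ one := hφ _ (by simp [one])
  have hφc : ∀ v, 0 ≤ φ (e v) := by
    intro v
    rcases (hc v).eq_or_lt with h | h
    · have : e v = 0 := Subtype.ext h.symm
      simp [this]
    · exact (hφ _ (by simp [e, h])).le
  have hrat : ∀ i, (x i : ℚ) * φ one = ∑ v, φ (e v) * ((v : Fin d → ℤ) i : ℚ) := by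
    intro i
    have hV : (x i : ℚ) • one = ∑ v : t, ((v : Fin d → ℤ) i : ℚ) • e v := by
      apply Subtype.ext
      have h := congrFun hxc i
      rw [← Finset.sum_coe_sort] at h
      simpa [toR, one, e, Rat.smul_def, mul_comm] using h
    have h := congrArg φ hV
    simpa [mul_comm] using h
  obtain ⟨D, hD, n, hn⟩ := exists_nat_mul_eq (Finset.univ : Finset (Option t))
    (fun o => o.elim (φ one) (φ ∘ e)) (by rintro (_ | v) -; exacts [hφ1.le, hφc v])
  have hn0 := hn none (Finset.mem_univ _)
  have hns := fun v => hn (some v) (Finset.mem_univ _)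
  simp only [Option.elim_none, Option.elim_some, Function.comp_apply] at hn0 hns
  refine ⟨n none, ?_, ?_⟩
  · have : (0 : ℚ) < n none := hn0 ▸ mul_pos (by exact_mod_cast hD) hφ1
    exact_mod_cast this
  · have : n none • x = ∑ v : t, n (some v) • (v : Fin d → ℤ) := by
      ext i
      have h : (n none : ℚ) * x i = ∑ v : t, (n (some v) : ℚ) * ((v : Fin d → ℤ) i : ℚ) := by
        rw [← hn0, mul_assoc, mul_comm (φ one), hrat, Finset.mul_sum]
        exact Finset.sum_congr rfl fun v _ => by rw [← hns, mul_assoc]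
      simp only [Pi.smul_apply, Finset.sum_apply, nsmul_eq_mul]
      exact_mod_cast h
    rw [this]
    exact sum_mem fun v _ => nsmul_mem (AddSubmonoid.subset_closure (hts v.2)) _

/-! ### Faces -/

theorem IsFace.mem_of_toR_mem_cone {d : ℕ} {A F : Set (Fin d → ℤ)} (hF : IsFace A F)
    {v : Fin d → ℤ} (hv : v ∈ A) (h : toR v ∈ cone F) : v ∈ F := by
  have : toR v ∈ toR '' F := hF.2.2 ▸ ⟨h, v, hv, rfl⟩
  obtain ⟨w, hw, e⟩ := this
  exact toR_injective e ▸ hw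

theorem IsFace.left_mem_cone {d : ℕ} {A F : Set (Fin d → ℤ)} (hF : IsFace A F)
    {x y : Fin d → ℝ} (hx : x ∈ cone A) (hy : y ∈ cone A) (hxy : x + y ∈ cone F) :
    x ∈ cone F := by
  have h := hF.2.1.left_mem_of_mem_openSegment (smul_mem_cone zero_le_two hx)
    (smul_mem_cone zero_le_two hy) hxy
    ⟨1 / 2, 1 / 2, by norm_num, by norm_num, by norm_num, by simp [smul_smul]⟩
  simpa [smul_smul] using smul_mem_cone (r := 1 / 2) (by norm_num) h

theorem IsFace.mem_NSemi_of_toR_mem_cone {d : ℕ} {A F : Set (Fin d → ℤ)} (hF : IsFace A F)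
    {v : Fin d → ℤ} (hv : v ∈ NSemi A) (h : toR v ∈ cone F) : v ∈ NSemi F := by
  induction hv using AddSubmonoid.closure_induction with
  | mem x hx => exact AddSubmonoid.subset_closure (hF.mem_of_toR_mem_cone hx h)
  | zero => exact zero_mem _
  | add x y hx hy ihx ihy =>
    rw [toR_add] at h
    have hx' := toR_mem_cone_of_mem_NSemi hx
    have hy' := toR_mem_cone_of_mem_NSemi hy
    exact add_mem (ihx (hF.left_mem_cone hx' hy' h))
      (ihy (hF.left_mem_cone hy' hx' (add_comm (toR x) (toR y) ▸ h)))

theorem IsFace.add_mem_NSemi_iff {d : ℕ} {A F : Set (Fin d → ℤ)} (hF : IsFace A F)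
    {v w : Fin d → ℤ} (hv : v ∈ NSemi A) (hw : w ∈ NSemi A) :
    v + w ∈ NSemi F ↔ v ∈ NSemi F ∧ w ∈ NSemi F := by
  refine ⟨fun h => ?_, fun h => add_mem h.1 h.2⟩
  have hv' := toR_mem_cone_of_mem_NSemi hv
  have hw' := toR_mem_cone_of_mem_NSemi hw
  have h' := toR_add v w ▸ toR_mem_cone_of_mem_NSemi h
  exact ⟨hF.mem_NSemi_of_toR_mem_cone hv (hF.left_mem_cone hv' hw' h'),
    hF.mem_NSemi_of_toR_mem_cone hw (hF.left_mem_cone hw' hv' (add_comm (toR v) (toR w) ▸ h'))⟩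

theorem IsFace.mem_of_mem_NSemi {d : ℕ} {A F : Set (Fin d → ℤ)} (hF : IsFace A F)
    {v : Fin d → ℤ} (hv : v ∈ A) (h : v ∈ NSemi F) : v ∈ F :=
  hF.mem_of_toR_mem_cone hv (toR_mem_cone_of_mem_NSemi h)

theorem NSemi_mono {d : ℕ} {S T : Set (Fin d → ℤ)} (h : S ⊆ T) : NSemi S ≤ NSemi T :=
  AddSubmonoid.closure_mono h

/-- The elements of `A` bounded above, in the order of the cone over `A`, by a multiple of `w`:
these are the elements on the smallest face of `A` whose cone contains `w`. -/
def faceOf {d : ℕ} (A : Set (Fin d → ℤ)) (w : Fin d → ℝ) : Set (Fin d → ℤ) :=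
  {g ∈ A | ∃ r : ℝ, 0 ≤ r ∧ r • w - toR g ∈ cone A}

theorem mem_cone_faceOf_iff {d : ℕ} {A : Set (Fin d → ℤ)} {w : Fin d → ℝ}
    {x : Fin d → ℝ} :
    x ∈ cone (faceOf A w) ↔ x ∈ cone A ∧ ∃ r : ℝ, 0 ≤ r ∧ r • w - x ∈ cone A := by
  classical
  constructor
  · intro hx
    refine ⟨cone_mono (fun _ h => h.1) hx, ?_⟩
    rw [mem_cone_iff] at hx
    induction hx using Submodule.span_induction with
    | mem x hx =>
      obtain ⟨g, hg, rfl⟩ := hx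
      exact hg.2
    | zero => exact ⟨0, le_rfl, by simpa using zero_mem_cone⟩
    | add x y _ _ hx hy =>
      obtain ⟨r, hr, hx⟩ := hx
      obtain ⟨s, hs, hy⟩ := hy
      refine ⟨r + s, add_nonneg hr hs, ?_⟩
      have := add_mem_cone hx hy
      rwa [sub_add_sub_comm, ← add_smul] at this
    | smul c x _ hx =>
      obtain ⟨r, hr, hx⟩ := hx
      refine ⟨c * r, mul_nonneg c.2 hr, ?_⟩
      have := smul_mem_cone c.2 hx
      rwa [smul_sub, smul_smul] at this
  · rintro ⟨⟨t, c, hts, hc, rfl⟩, r, hr, hx⟩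
    refine sum_mem_cone fun v hv => ?_
    rcases (hc v).eq_or_lt with h | h
    · rw [← h, zero_smul]
      exact zero_mem_cone
    refine smul_mem_cone (hc v) (toR_mem_cone ⟨hts hv, (c v)⁻¹ * r, by positivity, ?_⟩)
    have h1 : r • w - c v • toR v ∈ cone A := by
      rw [← Finset.add_sum_erase _ _ hv] at hx
      have h2 : ∑ u ∈ t.erase v, c u • toR u ∈ cone A := sum_mem_cone fun u hu =>
        smul_mem_cone (hc u) (toR_mem_cone (hts (Finset.mem_of_mem_erase hu)))
      have := add_mem_cone hx h2
      rwa [← sub_sub, sub_add_cancel] at this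
    have := smul_mem_cone (inv_nonneg.2 (hc v)) h1
    rwa [smul_sub, smul_smul, smul_smul, inv_mul_cancel₀ h.ne', one_smul] at this

theorem isFace_faceOf {d : ℕ} (A : Set (Fin d → ℤ)) (w : Fin d → ℝ) :
    IsFace A (faceOf A w) := by
  have hsub : faceOf A w ⊆ A := fun _ h => h.1
  refine ⟨hsub, ⟨cone_mono hsub, ?_⟩, ?_⟩
  · rintro x hx y hy z hz ⟨α, β, hα, hβ, -, rfl⟩
    obtain ⟨-, r, hr, h⟩ := mem_cone_faceOf_iff.1 hz
    refine mem_cone_faceOf_iff.2 ⟨hx, α⁻¹ * r, by positivity, ?_⟩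
    have h1 := add_mem_cone h (smul_mem_cone hβ.le hy)
    rw [← sub_sub, sub_add_cancel] at h1
    have := smul_mem_cone (inv_nonneg.2 hα.le) h1
    rwa [smul_sub, smul_smul, smul_smul, inv_mul_cancel₀ hα.ne', one_smul] at this
  · apply Set.Subset.antisymm
    · rintro _ ⟨hx, v, hv, rfl⟩
      exact ⟨v, ⟨hv, (mem_cone_faceOf_iff.1 hx).2⟩, rfl⟩
    · rintro _ ⟨v, hv, rfl⟩
      exact ⟨toR_mem_cone hv, v, hv.1, rfl⟩

/-- An element of `ℕG`, for `G` the smallest face of `A` whose cone contains `w ∈ ℕA`, divides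
some multiple of `w` in `ℕA`. -/
theorem exists_nsmul_sub_mem_NSemi {d : ℕ} {A : Set (Fin d → ℤ)} {w g : Fin d → ℤ}
    (hw : w ∈ NSemi A) (hg : g ∈ NSemi (faceOf A (toR w))) :
    ∃ n : ℕ, n • w - g ∈ NSemi A := by
  obtain ⟨hgA, r, hr, h⟩ := mem_cone_faceOf_iff.1 (toR_mem_cone_of_mem_NSemi hg)
  obtain ⟨N, hN⟩ := exists_nat_ge r
  have h1 : toR (N • w - g) ∈ cone A := by
    have := add_mem_cone h
      (smul_mem_cone (sub_nonneg.2 hN) (toR_mem_cone_of_mem_NSemi hw))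
    convert this using 1
    rw [toR_sub, toR_nsmul, sub_smul]
    abel
  obtain ⟨m, hm, h2⟩ := exists_nsmul_mem_NSemi h1
  obtain ⟨m, rfl⟩ := Nat.exists_eq_add_of_lt hm
  refine ⟨(0 + m + 1) * N, ?_⟩
  have h3 := add_mem h2
    (nsmul_mem (NSemi_mono (isFace_faceOf A (toR w)).1 hg) m)
  convert h3 using 1
  rw [smul_sub, mul_smul, zero_add, add_smul m 1 g, one_smul]
  abel

/-! ### Standard pairs -/

theorem mem_cell_self {d : ℕ} (a : Fin d → ℤ) (F : Set (Fin d → ℤ)) : a ∈ cell a F :=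
  ⟨0, zero_mem _, (add_zero a).symm⟩

theorem add_mem_cell {d : ℕ} {a f : Fin d → ℤ} {F : Set (Fin d → ℤ)} (hf : f ∈ NSemi F) :
    a + f ∈ cell a F :=
  ⟨f, hf, rfl⟩

theorem cell_subset_cell {d : ℕ} {a b : Fin d → ℤ} {F G : Set (Fin d → ℤ)} (hFG : F ⊆ G)
    (h : a - b ∈ NSemi G) : cell a F ⊆ cell b G := by
  rintro _ ⟨f, hf, rfl⟩
  exact ⟨a - b + f, add_mem h (NSemi_mono hFG hf), by abel⟩

theorem sub_mem_of_cell_subset {d : ℕ} {a b : Fin d → ℤ} {F G : Set (Fin d → ℤ)}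
    (h : cell a F ⊆ cell b G) : a - b ∈ NSemi G := by
  obtain ⟨g, hg, e⟩ := h (mem_cell_self a F)
  rwa [e, add_sub_cancel_left]

/-- An inclusion `a + ℕF ⊆ b + ℕG` into a cell on a face `G` forces `F ⊆ G`. -/
theorem subset_of_cell_subset {d : ℕ} {A : Set (Fin d → ℤ)} {a b : Fin d → ℤ}
    {F G : Set (Fin d → ℤ)} (hFA : F ⊆ A) (hG : IsFace A G) (h : cell a F ⊆ cell b G) :
    F ⊆ G := by
  intro f hf
  obtain ⟨g, hg, e⟩ := h (add_mem_cell (AddSubmonoid.subset_closure hf))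
  have hab := sub_mem_of_cell_subset h
  have hfA : f ∈ NSemi A := AddSubmonoid.subset_closure (hFA hf)
  refine hG.mem_of_mem_NSemi (hFA hf)
    ((hG.add_mem_NSemi_iff (NSemi_mono hG.1 hab) hfA).1 ?_).2
  have : a - b + f = g := by rw [sub_add_eq_add_sub, e, add_sub_cancel_left]
  rwa [this]

/-- Divisibility in `ℕA` is a well quasi-order. -/
theorem exists_lt_sub_mem_NSemi {d : ℕ} {A : Set (Fin d → ℤ)} (hA : A.Finite)
    (u : ℕ → Fin d → ℤ) (hu : ∀ n, u n ∈ NSemi A) :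
    ∃ m n, m < n ∧ u n - u m ∈ NSemi A := by
  lift A to Finset (Fin d → ℤ) using hA
  choose c hc using fun n => AddSubmonoid.mem_closure_finset'.1 (hu n)
  obtain ⟨m, n, hmn, h⟩ := wellQuasiOrdered_le c
  refine ⟨m, n, hmn, ?_⟩
  have : u n - u m = ∑ i, (c n i - c m i) • (i : Fin d → ℤ) := by
    rw [hc, hc, ← Finset.sum_sub_distrib]
    refine Finset.sum_congr rfl fun i _ => ?_
    rw [sub_eq_iff_eq_add, ← add_smul, Nat.sub_add_cancel (h i)]
  rw [this]
  exact sum_mem fun i _ => nsmul_mem (AddSubmonoid.subset_closure i.2) _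

theorem IsConfig.eq_zero_of_neg_mem {d : ℕ} {A : Set (Fin d → ℤ)} (hA : IsConfig A)
    {v : Fin d → ℤ} (hv : v ∈ NSemi A) (hv' : -v ∈ NSemi A) : v = 0 := by
  refine toR_injective ((hA.pointed _ (toR_mem_cone_of_mem_NSemi hv) ?_).trans toR_zero.symm)
  have := toR_mem_cone_of_mem_NSemi hv'
  rwa [← zero_sub, toR_sub, toR_zero, zero_sub] at this

/-- Proper divisibility in `ℕA` is well-founded. -/
theorem IsConfig.wellFounded {d : ℕ} {A : Set (Fin d → ℤ)} (hA : IsConfig A) :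
    WellFounded fun v w : NSemi A => (w - v : Fin d → ℤ) ∈ NSemi A ∧ v ≠ w := by
  refine wellFounded_iff_isEmpty_descending_chain.2 ⟨fun ⟨u, hu⟩ => ?_⟩
  have anti : ∀ m k, (u m - u (m + k) : Fin d → ℤ) ∈ NSemi A := by
    intro m k
    induction k with
    | zero => simp
    | succ k ih => simpa [add_assoc] using add_mem ih (hu (m + k)).1
  obtain ⟨m, n, hmn, h⟩ := exists_lt_sub_mem_NSemi hA.finite (fun n => u n) fun n => (u n).2
  obtain ⟨k, rfl⟩ := Nat.exists_eq_add_of_lt hmn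
  have h1 : (u m - u (m + 1) : Fin d → ℤ) ∈ NSemi A := (hu m).1
  have h2 : (u (m + 1) - u m : Fin d → ℤ) ∈ NSemi A := by
    have := add_mem (anti (m + 1) k) h
    rw [add_right_comm m 1 k] at this
    simpa using this
  have := hA.eq_zero_of_neg_mem h1 (by rwa [neg_sub])
  exact (hu m).2 (Subtype.ext (sub_eq_zero.1 this).symm)

theorem exists_stdPair {d : ℕ} {A E F : Set (Fin d → ℤ)} (hA : IsConfig A)
    (hE : IsExpSet A E) {b : Fin d → ℤ} (hb : ProperPair A E b F)
    (h : ∀ s ∈ A \ F, ∃ n : ℕ, b + n • s ∈ E) : ∃ a, StdPair A E a F := by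
  obtain ⟨hbA, hF, hbE⟩ := hb
  obtain ⟨a, ha, hmin⟩ := hA.wellFounded.has_min {a : NSemi A | b - a ∈ NSemi F}
    ⟨⟨b, hbA⟩, by simp⟩
  refine ⟨a, ⟨a.2, hF, ?_⟩, ?_⟩
  · rintro _ ⟨f, hf, rfl⟩
    refine ⟨add_mem a.2 (NSemi_mono hF.1 hf), fun hmem => (hbE (add_mem_cell hf)).2 ?_⟩
    have := hE.2 _ hmem _ (NSemi_mono hF.1 ha)
    rwa [show (a : Fin d → ℤ) + f + (b - a) = b + f by abel] at this
  · rintro c G ⟨hcA, hG, hcE⟩ hsub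
    have hFG := subset_of_cell_subset hF.1 hG hsub
    have hac := sub_mem_of_cell_subset hsub
    have hGF : G ⊆ F := by
      intro s hs
      by_contra hsF
      obtain ⟨n, hn⟩ := h s ⟨hG.1 hs, hsF⟩
      have hmem : b + n • s ∈ cell c G := by
        refine ⟨b - a + (a - c) + n • s, add_mem (add_mem (NSemi_mono hFG ha) hac)
          (nsmul_mem (AddSubmonoid.subset_closure hs) n), by abel⟩
      exact (hcE hmem).2 hn
    obtain rfl := hFG.antisymm hGF
    have hbc : b - c ∈ NSemi F := by
      have := add_mem ha hac
      rwa [sub_add_sub_cancel] at this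
    have : (⟨c, hcA⟩ : NSemi A) = a := by
      by_contra hne
      exact hmin ⟨c, hcA⟩ hbc ⟨NSemi_mono hF.1 hac, hne⟩
    rw [← this]

theorem StdPair.exists_mem {d : ℕ} {A E F : Set (Fin d → ℤ)} (hA : A.Finite)
    (hE : IsExpSet A E) {a : Fin d → ℤ} (ha : StdPair A E a F) {s : Fin d → ℤ}
    (hs : s ∈ A \ F) : ∃ n : ℕ, ∃ f ∈ NSemi F, a + f + n • s ∈ E := by
  classical
  obtain ⟨⟨haA, hF, -⟩, hmax⟩ := ha
  have hFfin : F.Finite := hA.subset hF.1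
  set σ : Fin d → ℤ := ∑ f ∈ hFfin.toFinset, f with hσ
  have hσF : σ ∈ NSemi F := sum_mem fun f hf =>
    AddSubmonoid.subset_closure (hFfin.mem_toFinset.1 hf)
  have hsA : s ∈ NSemi A := AddSubmonoid.subset_closure hs.1
  have hw : σ + s ∈ NSemi A := add_mem (NSemi_mono hF.1 hσF) hsA
  set G := faceOf A (toR (σ + s)) with hG
  have hFG : F ⊆ G := by
    refine fun f hf => ⟨hF.1 hf, 1, zero_le_one, ?_⟩
    rw [one_smul, ← toR_sub]
    apply toR_mem_cone_of_mem_NSemi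
    rw [hσ, ← Finset.add_sum_erase _ _ (hFfin.mem_toFinset.2 hf), add_assoc,
      add_sub_cancel_left]
    exact add_mem (sum_mem fun g hg => AddSubmonoid.subset_closure
      (hF.1 (hFfin.mem_toFinset.1 (Finset.mem_of_mem_erase hg)))) hsA
  have hsG : s ∈ G := by
    refine ⟨hs.1, 1, zero_le_one, ?_⟩
    rw [one_smul, ← toR_sub, add_sub_cancel_right]
    exact toR_mem_cone_of_mem_NSemi (NSemi_mono hF.1 hσF)
  have hGface : IsFace A G := isFace_faceOf A _
  have hnot : ¬ cell a G ⊆ stdSet A E := fun hprop =>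
    hs.2 (subset_of_cell_subset hGface.1 hF (hmax a G ⟨haA, hGface, hprop⟩
      (cell_subset_cell hFG (by simp))) hsG)
  obtain ⟨_, ⟨g, hg, rfl⟩, hagE⟩ := Set.not_subset.1 hnot
  have hag : a + g ∈ E := by
    by_contra hne
    exact hagE ⟨add_mem haA (NSemi_mono hGface.1 hg), hne⟩
  obtain ⟨n, hn⟩ := exists_nsmul_sub_mem_NSemi hw hg
  refine ⟨n, n • σ, nsmul_mem hσF n, ?_⟩
  have := hE.2 _ hag _ hn
  convert this using 1
  rw [smul_add]
  abel

/-- A monomial not on the face `F` is divisible by a generator outside `F`. -/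
theorem exists_generator_sub_mem {d : ℕ} {A F : Set (Fin d → ℤ)} {c : Fin d → ℤ}
    (hc : c ∈ NSemi A) (hcF : c ∉ NSemi F) : ∃ s ∈ A \ F, c - s ∈ NSemi A := by
  induction hc using AddSubmonoid.closure_induction with
  | mem x hx =>
    exact ⟨x, ⟨hx, fun h => hcF (AddSubmonoid.subset_closure h)⟩, by simp⟩
  | zero => exact absurd (zero_mem _) hcF
  | add x y hx hy ihx ihy =>
    by_cases h : x ∈ NSemi F
    · obtain ⟨s, hs, hys⟩ := ihy fun h' => hcF (add_mem h h')
      exact ⟨s, hs, by rw [add_sub_assoc]; exact add_mem hx hys⟩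
    · obtain ⟨s, hs, hxs⟩ := ihx h
      exact ⟨s, hs, by rw [add_sub_right_comm]; exact add_mem hxs hy⟩

/-- A single multiple of `a` by an element of `ℕF` works for all generators outside `F`. -/
theorem StdPair.exists_common_mem {d : ℕ} {A E F : Set (Fin d → ℤ)} (hA : A.Finite)
    (hE : IsExpSet A E) {a : Fin d → ℤ} (ha : StdPair A E a F) :
    ∃ f ∈ NSemi F, ∀ c ∈ NSemi A, c ∉ NSemi F → ∃ n : ℕ, a + f + n • c ∈ E := by
  classical
  choose! n f hf hmem using fun s (hs : s ∈ A \ F) => ha.exists_mem hA hE hs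
  have hfin : (A \ F).Finite := hA.subset Set.sdiff_subset
  refine ⟨∑ s ∈ hfin.toFinset, f s, sum_mem fun s hs => hf s (hfin.mem_toFinset.1 hs),
    fun c hc hcF => ?_⟩
  obtain ⟨s, hs, hcs⟩ := exists_generator_sub_mem hc hcF
  refine ⟨n s, ?_⟩
  have h1 : ∑ t ∈ hfin.toFinset.erase s, f t ∈ NSemi A := sum_mem fun t ht =>
    NSemi_mono ha.1.2.1.1 (hf t (hfin.mem_toFinset.1 (Finset.mem_of_mem_erase ht)))
  have := hE.2 _ (hmem s hs) _ (add_mem h1 (nsmul_mem hcs (n s)))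
  convert this using 1
  rw [← Finset.add_sum_erase _ _ (hfin.mem_toFinset.2 hs), smul_sub]
  abel

/-! ### Monomial ideals -/

theorem mono_add {d : ℕ} {k : Type*} [Field k] {A : Set (Fin d → ℤ)} (a b : NSemi A) :
    mono k A (a + b) = mono k A a * mono k A b := by
  simp [mono, AddMonoidAlgebra.single_mul_single]

theorem mono_nsmul {d : ℕ} {k : Type*} [Field k] {A : Set (Fin d → ℤ)} (n : ℕ) (a : NSemi A) :
    mono k A (n • a) = mono k A a ^ n := by
  simp [mono, AddMonoidAlgebra.single_pow]

theorem IsMonomialIdeal.mem_iff {d : ℕ} {k : Type*} [Field k] {A : Set (Fin d → ℤ)}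
    {I : Ideal (SGRing k A)} (hI : IsMonomialIdeal k A I) {x : SGRing k A} :
    x ∈ I ↔ ∀ m ∈ x.coeff.support, mono k A m ∈ I := by
  obtain ⟨S, rfl⟩ := hI
  constructor
  · intro hx m hm
    obtain ⟨m', hm', c, rfl⟩ := AddMonoidAlgebra.mem_ideal_span_of'_image.1 hx m hm
    rw [mono_add]
    exact Ideal.mul_mem_left _ _ (Ideal.subset_span ⟨m', hm', rfl⟩)
  · intro h
    refine AddMonoidAlgebra.mem_ideal_span_of'_image.2 fun m hm => ?_
    exact AddMonoidAlgebra.mem_ideal_span_of'_image.1 (h m hm) m (by simp [mono])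

theorem IsMonomialIdeal.mono_mul_mem_iff {d : ℕ} {k : Type*} [Field k] {A : Set (Fin d → ℤ)}
    {I : Ideal (SGRing k A)} (hI : IsMonomialIdeal k A I) {c : NSemi A} {x : SGRing k A} :
    mono k A c * x ∈ I ↔ ∀ m ∈ x.coeff.support, mono k A (c + m) ∈ I := by
  constructor
  · intro h m hm
    refine hI.mem_iff.1 h (c + m) ?_
    rw [Finsupp.mem_support_iff] at hm ⊢
    rwa [mono, AddMonoidAlgebra.coeff_single_mul_add, one_mul]
  · intro h
    rw [← AddMonoidAlgebra.sum_coeff_single x, Finsupp.sum, Finset.mul_sum]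
    refine Ideal.sum_mem _ fun m hm => ?_
    have : mono k A c * AddMonoidAlgebra.single m (x.coeff m) =
        AddMonoidAlgebra.single 0 (x.coeff m) * mono k A (c + m) := by
      simp [mono, AddMonoidAlgebra.single_mul_single]
    rw [this]
    exact Ideal.mul_mem_left _ _ (h m hm)

theorem mem_expSet_iff {d : ℕ} {k : Type*} [Field k] {A : Set (Fin d → ℤ)}
    {I : Ideal (SGRing k A)} {a : NSemi A} :
    (a : Fin d → ℤ) ∈ expSet k A I ↔ mono k A a ∈ I :=
  ⟨fun ⟨_, h⟩ => h, fun h => ⟨a.2, h⟩⟩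

theorem isExpSet_expSet {d : ℕ} {k : Type*} [Field k] {A : Set (Fin d → ℤ)}
    (I : Ideal (SGRing k A)) : IsExpSet A (expSet k A I) := by
  refine ⟨fun _ h => h.1, ?_⟩
  rintro e ⟨he, h⟩ c hc
  refine (mem_expSet_iff (k := k) (a := ⟨e, he⟩ + ⟨c, hc⟩)).2 ?_
  rw [mono_add]
  exact Ideal.mul_mem_right _ _ h

/-- The prime `p_F` consists of the elements without a monomial on the face `F`. -/
theorem mem_primeF_iff {d : ℕ} {k : Type*} [Field k] {A F : Set (Fin d → ℤ)}
    (hF : IsFace A F) {x : SGRing k A} :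
    x ∈ primeF k A F ↔ ∀ m ∈ x.coeff.support, (m : Fin d → ℤ) ∉ NSemi F := by
  have h : primeF k A F = Ideal.span (AddMonoidAlgebra.of' k (NSemi A) ''
      {a | (a : Fin d → ℤ) ∉ NSemi F}) := by
    refine congrArg Ideal.span (Set.ext fun x => ?_)
    exact exists_congr fun a => and_congr_right' eq_comm
  rw [h, AddMonoidAlgebra.mem_ideal_span_of'_image]
  refine forall₂_congr fun m _ => ⟨?_, fun hm => ⟨m, hm, 0, (zero_add m).symm⟩⟩
  rintro ⟨m', hm', c, rfl⟩ hmem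
  exact hm' ((hF.add_mem_NSemi_iff c.2 m'.2).1 hmem).2

theorem mono_mem_primeF_iff {d : ℕ} {k : Type*} [Field k] {A F : Set (Fin d → ℤ)}
    (hF : IsFace A F) {a : NSemi A} :
    mono k A a ∈ primeF k A F ↔ (a : Fin d → ℤ) ∉ NSemi F := by
  rw [mem_primeF_iff hF]
  simp [mono]

open Classical in
/-- The monomials of `k[ℕA]`, with those outside the face `F` replaced by zero. -/
noncomputable def faceMonomial {d : ℕ} (k : Type*) [Field k] {A F : Set (Fin d → ℤ)}
    (hF : IsFace A F) : Multiplicative (NSemi A) →* AddMonoidAlgebra k (Fin d → ℤ) where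
  toFun a := if (a.toAdd : Fin d → ℤ) ∈ NSemi F then
    AddMonoidAlgebra.single (a.toAdd : Fin d → ℤ) 1 else 0
  map_one' := by simp [AddMonoidAlgebra.one_def]
  map_mul' a b := by
    have := hF.add_mem_NSemi_iff a.toAdd.2 b.toAdd.2
    by_cases ha : (a.toAdd : Fin d → ℤ) ∈ NSemi F <;>
    by_cases hb : (b.toAdd : Fin d → ℤ) ∈ NSemi F <;>
    simp [this, ha, hb, AddMonoidAlgebra.single_mul_single]

theorem ker_lift_faceMonomial {d : ℕ} (k : Type*) [Field k] {A F : Set (Fin d → ℤ)}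
    (hF : IsFace A F) :
    RingHom.ker (AddMonoidAlgebra.lift k _ _ (faceMonomial k hF)) = primeF k A F := by
  classical
  ext x
  rw [RingHom.mem_ker, mem_primeF_iff hF, AddMonoidAlgebra.lift_apply]
  constructor
  · intro h m hm hmF
    have := congrArg (fun y => y.coeff (m : Fin d → ℤ)) h
    simp only [Finsupp.sum, AddMonoidAlgebra.coeff_sum, Finsupp.finsetSum_apply] at this
    rw [Finset.sum_eq_single m] at this
    · simp [faceMonomial, hmF] at this
      exact (Finsupp.mem_support_iff.1 hm) this
    · intro n _ hnm
      have hne : (n : Fin d → ℤ) ≠ m := fun e => hnm (Subtype.ext e)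
      by_cases hn : (n : Fin d → ℤ) ∈ NSemi F <;>
        simp [faceMonomial, hn, hne]
    · exact fun h => absurd hm h
  · intro h
    refine Finset.sum_eq_zero fun m hm => ?_
    simp [faceMonomial, h m hm]

theorem isPrime_primeF {d : ℕ} (k : Type*) [Field k] {A F : Set (Fin d → ℤ)}
    (hF : IsFace A F) : (primeF k A F).IsPrime :=
  ker_lift_faceMonomial k hF ▸ RingHom.ker_isPrime _

theorem mem_radical_colon_mk_iff {R : Type*} [CommRing R] {I : Ideal R} {r y : R} :
    r ∈ ((⊥ : Submodule R (R ⧸ I)).colon {Ideal.Quotient.mk I y}).radical ↔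
      ∃ n : ℕ, r ^ n * y ∈ I := by
  simp only [Ideal.mem_radical_iff, Submodule.mem_colon_singleton, Submodule.mem_bot]
  refine exists_congr fun n => ?_
  rw [← Ideal.Quotient.eq_zero_iff_mem]
  rfl

theorem exists_stdPair_of_associatedPrime {d : ℕ} {k : Type*} [Field k]
    {A F : Set (Fin d → ℤ)} (hA : IsConfig A) (hF : IsFace A F)
    {I : Ideal (SGRing k A)} (hI : IsMonomialIdeal k A I)
    (h : primeF k A F ∈ associatedPrimes (SGRing k A) (SGRing k A ⧸ I)) :
    ∃ a, StdPair A (expSet k A I) a F := by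
  classical
  obtain ⟨-, x, hx⟩ := h
  obtain ⟨y, rfl⟩ := Ideal.Quotient.mk_surjective x
  have hmem : ∀ r, r ∈ primeF k A F ↔ ∃ n : ℕ, r ^ n * y ∈ I := fun r => by
    rw [hx, mem_radical_colon_mk_iff]
  obtain ⟨b, hb, hbF⟩ : ∃ b ∈ y.coeff.support, ∀ f : NSemi A, (f : Fin d → ℤ) ∈ NSemi F →
      mono k A (f + b) ∉ I := by
    by_contra! hcon
    choose! f hfF hfI using hcon
    let g : NSemi A := ∑ b ∈ y.coeff.support, f b
    have hgF : (g : Fin d → ℤ) ∈ NSemi F := by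
      rw [AddSubmonoid.coe_finsetSum]
      exact sum_mem hfF
    refine (mono_mem_primeF_iff (k := k) hF (a := g)).1 ((hmem _).2 ⟨1, ?_⟩) hgF
    rw [pow_one, hI.mono_mul_mem_iff]
    intro b hb
    have : g + b = (∑ c ∈ y.coeff.support.erase b, f c) + (f b + b) := by
      rw [← add_assoc, Finset.sum_erase_add _ _ hb]
    rw [this, mono_add]
    exact Ideal.mul_mem_left _ _ (hfI b hb)
  refine exists_stdPair hA (isExpSet_expSet I) (b := b) ⟨b.2, hF, ?_⟩ ?_
  · rintro _ ⟨f, hf, rfl⟩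
    have hfA := NSemi_mono hF.1 hf
    refine ⟨add_mem b.2 hfA, fun hE => hbF ⟨f, hfA⟩ hf ?_⟩
    rw [add_comm]
    exact mem_expSet_iff.1 hE
  · intro s hs
    let s' : NSemi A := ⟨s, AddSubmonoid.subset_closure hs.1⟩
    obtain ⟨n, hn⟩ := (hmem (mono k A s')).1 ((mono_mem_primeF_iff hF).2 fun h =>
      hs.2 (hF.mem_of_mem_NSemi hs.1 h))
    rw [← mono_nsmul, hI.mono_mul_mem_iff] at hn
    refine ⟨n, mem_expSet_iff (a := b + n • s').2 ?_⟩
    rw [add_comm]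
    exact hn b hb

theorem associatedPrime_of_stdPair {d : ℕ} {k : Type*} [Field k]
    {A F : Set (Fin d → ℤ)} (hA : A.Finite)
    {I : Ideal (SGRing k A)} (hI : IsMonomialIdeal k A I) {a : Fin d → ℤ}
    (ha : StdPair A (expSet k A I) a F) :
    primeF k A F ∈ associatedPrimes (SGRing k A) (SGRing k A ⧸ I) := by
  obtain ⟨haA, hF, haE⟩ := ha.1
  obtain ⟨f, hf, hmem⟩ := ha.exists_common_mem hA (isExpSet_expSet I)
  let b : NSemi A := ⟨a + f, add_mem haA (NSemi_mono hF.1 hf)⟩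
  have hprime := isPrime_primeF k hF
  refine ⟨hprime, Ideal.Quotient.mk I (mono k A b), le_antisymm ?_ fun r hr => ?_⟩
  · refine Ideal.span_le.2 ?_
    rintro _ ⟨c, hc, rfl⟩
    obtain ⟨n, hn⟩ := hmem c c.2 hc
    refine mem_radical_colon_mk_iff.2 ⟨n, ?_⟩
    rw [← mono_nsmul, ← mono_add, add_comm]
    exact mem_expSet_iff.1 hn
  · obtain ⟨n, hn⟩ := mem_radical_colon_mk_iff.1 hr
    refine hprime.mem_of_pow_mem n ((mem_primeF_iff hF).2 fun m hm hmF => ?_)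
    rw [mul_comm, hI.mono_mul_mem_iff] at hn
    refine (haE (add_mem_cell (add_mem hf hmF))).2 ?_
    rw [← add_assoc]
    exact mem_expSet_iff.2 (hn m hm)

/-- The prime `p_F` is an associated prime of the monomial ideal `I`
if and only if `I` has a standard pair belonging to `F`. -/
theorem associatedPrime_iff_stdPair {d : ℕ} (k : Type*) [Field k]
    (A : Set (Fin d → ℤ)) (hA : IsConfig A)
    (F : Set (Fin d → ℤ)) (hF : IsFace A F)
    (I : Ideal (SGRing k A)) (hI : IsMonomialIdeal k A I) :
    primeF k A F ∈ associatedPrimes (SGRing k A) (SGRing k A ⧸ I) ↔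
      ∃ a, StdPair A (expSet k A I) a F :=
  ⟨exists_stdPair_of_associatedPrime hA hF hI,
    fun ⟨_, ha⟩ => associatedPrime_of_stdPair hA.finite hI ha⟩

end StdPairsPaper
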